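/- arXiv:2209.02572 — 3 statements merged into one kernel-verified Lean document; each statement's English description precedes it below -/
import Mathlib

section
/- Suppose in addition that M is a ring satisfying val_M(mm') ≥ val_M(m) + val_M(m') for all m, m' ∈ M, and for c ∈ ℝ set M_c = {m ∈ M : val_M(m) ≥ c}. If f ∈ H_e^{λ,μ}(G,M) takes all its values in M_c and g ∈ H_e^{λ,ν}(G,M) takes all its values in M_{c'}, then the pointwise product fg takes values in M_{c+c'} and fg ∈ H_e^{λ,ξ}(G,M) with ξ = min(μ + c', ν + c). Consequently, for fixed λ, μ the set H_e^{λ,μ}(G,M_0) is a subring of the continuous functions G → M, and H_e^λ(G,M) is a subring of C⁰(G,M). -/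
/-- `f ∈ 𝓗_e^{λ,μ}(G,M)` for `G = ℤ_p^d` with filtration `G_i = (p^i ℤ_p)^d`. -/
def IsSH (p : ℕ) [Fact p.Prime] {d : ℕ} {M : Type*} [AddCommGroup M]
    (valM : M → WithTop ℝ) (e lam mu : ℝ) (f : (Fin d → ℤ_[p]) → M) : Prop :=
  ∀ (i : ℕ) (g h : Fin d → ℤ_[p]),
    (∀ j, (p : ℤ_[p]) ^ i ∣ (g j - h j)) →
    (((p : ℝ) ^ lam * (p : ℝ) ^ (e * (i : ℝ)) + mu : ℝ) : WithTop ℝ) ≤ valM (f g - f h)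

/-- `f : ℤ_p^d → M` is continuous for the valuation topology on `M`. -/
def ValContinuous (p : ℕ) [Fact p.Prime] {d : ℕ} {M : Type*} [AddCommGroup M]
    (valM : M → WithTop ℝ) (f : (Fin d → ℤ_[p]) → M) : Prop :=
  ∀ (g : Fin d → ℤ_[p]) (C : ℝ), ∃ i : ℕ, ∀ h : Fin d → ℤ_[p],
    (∀ j, (p : ℤ_[p]) ^ i ∣ (h j - g j)) → (C : WithTop ℝ) ≤ valM (f h - f g)

namespace IsSH

variable {p : ℕ} [Fact p.Prime] {d : ℕ} {e lam mu nu : ℝ}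

section AddCommGroup

variable {M : Type*} [AddCommGroup M] {valM : M → WithTop ℝ} {f g : (Fin d → ℤ_[p]) → M}

theorem mono (hf : IsSH p valM e lam mu f) (h : nu ≤ mu) : IsSH p valM e lam nu f :=
  fun i x y hxy => le_trans (WithTop.coe_le_coe.2 (by linarith)) (hf i x y hxy)

theorem const (h0 : valM 0 = ⊤) (m : M) :
    IsSH p valM e lam mu (fun _ : Fin d → ℤ_[p] => m) := by
  intro i x y _
  simp [h0]

theorem add (hadd : ∀ m m' : M, min (valM m) (valM m') ≤ valM (m + m'))
    (hf : IsSH p valM e lam mu f) (hg : IsSH p valM e lam mu g) :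
    IsSH p valM e lam mu (f + g) := by
  intro i x y hxy
  rw [Pi.add_apply, Pi.add_apply, add_sub_add_comm]
  exact le_trans (le_min (hf i x y hxy) (hg i x y hxy)) (hadd _ _)

theorem neg (hneg : ∀ m : M, valM (-m) = valM m) (hf : IsSH p valM e lam mu f) :
    IsSH p valM e lam mu (-f) := by
  intro i x y hxy
  rw [Pi.neg_apply, Pi.neg_apply, ← neg_sub', hneg]
  exact hf i x y hxy

/-- Super-Hölder functions are bounded below in valuation. -/
theorem exists_le_val
    (hadd : ∀ m m' : M, min (valM m) (valM m') ≤ valM (m + m'))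
    (hf : IsSH p valM e lam mu f) : ∃ c : ℝ, ∀ x, (c : WithTop ℝ) ≤ valM (f x) := by
  obtain ⟨a, ha⟩ : ∃ a : ℝ, (a : WithTop ℝ) ≤ valM (f 0) := by
    by_cases h : valM (f 0) = ⊤
    · exact ⟨0, h ▸ le_top⟩
    · exact ⟨(valM (f 0)).untop h, (WithTop.coe_untop _ h).le⟩
  refine ⟨min ((p : ℝ) ^ lam * (p : ℝ) ^ (e * ((0 : ℕ) : ℝ)) + mu) a, fun x => ?_⟩
  have h := hadd (f x - f 0) (f 0)
  rw [sub_add_cancel] at h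
  refine le_trans (le_min ?_ ?_) h
  · exact le_trans (WithTop.coe_le_coe.2 (min_le_left _ _)) (hf 0 x 0 (by simp))
  · exact le_trans (WithTop.coe_le_coe.2 (min_le_right _ _)) ha

theorem valContinuous (he : 0 < e) (hf : IsSH p valM e lam mu f) : ValContinuous p valM f := by
  intro x C
  have hp : (1 : ℝ) < p := by exact_mod_cast (Fact.out : p.Prime).one_lt
  have hpe : 1 < (p : ℝ) ^ e := Real.one_lt_rpow hp he
  have hpl : 0 < (p : ℝ) ^ lam := Real.rpow_pos_of_pos (by linarith) _
  obtain ⟨i, hi⟩ := pow_unbounded_of_one_lt ((C - mu) / (p : ℝ) ^ lam) hpe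
  refine ⟨i, fun y hy => le_trans (WithTop.coe_le_coe.2 ?_) (hf i y x hy)⟩
  rw [Real.rpow_mul (by linarith), Real.rpow_natCast]
  rw [div_lt_iff₀ hpl] at hi
  linarith

end AddCommGroup

theorem mul {M : Type*} [Ring M] {valM : M → WithTop ℝ} {f g : (Fin d → ℤ_[p]) → M} {c c' : ℝ}
    (hadd : ∀ m m' : M, min (valM m) (valM m') ≤ valM (m + m'))
    (hmul : ∀ m m' : M, valM m + valM m' ≤ valM (m * m'))
    (hf : IsSH p valM e lam mu f) (hfc : ∀ x, (c : WithTop ℝ) ≤ valM (f x))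
    (hg : IsSH p valM e lam nu g) (hgc : ∀ x, (c' : WithTop ℝ) ≤ valM (g x)) :
    IsSH p valM e lam (min (mu + c') (nu + c)) (f * g) := by
  intro i x y hxy
  have key : (f * g) x - (f * g) y = (f x - f y) * g x + f y * (g x - g y) := by
    simp only [Pi.mul_apply]
    noncomm_ring
  rw [key]
  refine le_trans (le_min ?_ ?_) (hadd _ _)
  · refine le_trans ?_ (le_trans (add_le_add (hf i x y hxy) (hgc x)) (hmul _ _))
    rw [← WithTop.coe_add, WithTop.coe_le_coe]
    linarith [min_le_left (mu + c') (nu + c)]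
  · refine le_trans ?_ (le_trans (add_le_add (hfc y) (hg i x y hxy)) (hmul _ _))
    rw [← WithTop.coe_add, WithTop.coe_le_coe]
    linarith [min_le_right (mu + c') (nu + c)]

end IsSH

/-- Suppose `M` is a ring with `val_M (m m') ≥ val_M m + val_M m'`
and `M_c = {m | val_M m ≥ c}`. If `f ∈ 𝓗_e^{λ,μ}(G,M)` takes values in `M_c` and
`g ∈ 𝓗_e^{λ,ν}(G,M)` takes values in `M_{c'}`, then `fg` takes values in `M_{c+c'}`
and `fg ∈ 𝓗_e^{λ, min(μ+c', ν+c)}(G,M)`.  Consequently `𝓗_e^{λ,μ}(G,M_0)` is a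
subring of the continuous functions `G → M`, and `𝓗_e^λ(G,M)` is a subring of
`C⁰(G,M)`. -/
theorem sh_ring
    (p : ℕ) [Fact p.Prime] (E : Type*) [Field E] [CharP E p]
    (M : Type*) [Ring M] [Module E M]
    (valM : M → WithTop ℝ)
    (hMtop : ∀ m : M, valM m = ⊤ ↔ m = 0)
    (hMadd : ∀ m m' : M, min (valM m) (valM m') ≤ valM (m + m'))
    (hMsmul : ∀ (x : E) (m : M), x ≠ 0 → valM (x • m) = valM m)
    (hMmul : ∀ m m' : M, valM m + valM m' ≤ valM (m * m'))
    (hMone : valM 1 = 0)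
    (d : ℕ) (hd : 1 ≤ d) (e : ℝ) (he : 0 < e) (lam : ℝ) :
    (∀ (c c' mu nu : ℝ) (f g : (Fin d → ℤ_[p]) → M),
        IsSH p valM e lam mu f → (∀ x, (c : WithTop ℝ) ≤ valM (f x)) →
        IsSH p valM e lam nu g → (∀ x, (c' : WithTop ℝ) ≤ valM (g x)) →
        (∀ x, ((c + c' : ℝ) : WithTop ℝ) ≤ valM (f x * g x)) ∧
          IsSH p valM e lam (min (mu + c') (nu + c)) (f * g)) ∧
    (∀ mu : ℝ, ∃ S : Subring ((Fin d → ℤ_[p]) → M),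
        (S : Set ((Fin d → ℤ_[p]) → M)) =
          {f | IsSH p valM e lam mu f ∧ ∀ x, (0 : WithTop ℝ) ≤ valM (f x)} ∧
        ∀ f ∈ S, ValContinuous p valM f) ∧
    (∃ S : Subring ((Fin d → ℤ_[p]) → M),
        (S : Set ((Fin d → ℤ_[p]) → M)) = {f | ∃ mu, IsSH p valM e lam mu f} ∧
        ∀ f ∈ S, ValContinuous p valM f) := by
  have h0 : valM 0 = ⊤ := (hMtop 0).2 rfl
  have hneg : ∀ m : M, valM (-m) = valM m := fun m => by
    simpa using hMsmul (-1 : E) m (by simp)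
  refine ⟨fun c c' mu nu f g hf hfc hg hgc => ⟨fun x => ?_, hf.mul hMadd hMmul hfc hg hgc⟩,
    fun mu => ?_, ?_⟩
  · rw [WithTop.coe_add]
    exact le_trans (add_le_add (hfc x) (hgc x)) (hMmul _ _)
  · refine ⟨{ carrier := {f | IsSH p valM e lam mu f ∧ ∀ x, (0 : WithTop ℝ) ≤ valM (f x)}
              mul_mem' := ?_, one_mem' := ?_, add_mem' := ?_, zero_mem' := ?_,
              neg_mem' := ?_ }, rfl, fun f hf => hf.1.valContinuous he⟩
    · rintro f g ⟨hf, hf0⟩ ⟨hg, hg0⟩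
      refine ⟨?_, fun x => le_trans (add_nonneg (hf0 x) (hg0 x)) (hMmul _ _)⟩
      simpa using hf.mul (c := 0) (c' := 0) hMadd hMmul hf0 hg hg0
    · exact ⟨IsSH.const h0 1, fun _ => hMone.ge⟩
    · rintro f g ⟨hf, hf0⟩ ⟨hg, hg0⟩
      exact ⟨hf.add hMadd hg, fun x => le_trans (le_min (hf0 x) (hg0 x)) (hMadd _ _)⟩
    · exact ⟨IsSH.const h0 0, fun _ => h0 ▸ le_top⟩
    · rintro f ⟨hf, hf0⟩
      exact ⟨hf.neg hneg, fun x => (hf0 x).trans (hneg _).ge⟩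
  · refine ⟨{ carrier := {f | ∃ mu, IsSH p valM e lam mu f}
              mul_mem' := ?_, one_mem' := ?_, add_mem' := ?_, zero_mem' := ?_,
              neg_mem' := ?_ }, rfl, fun f ⟨_, hf⟩ => hf.valContinuous he⟩
    · rintro f g ⟨mu, hf⟩ ⟨nu, hg⟩
      obtain ⟨c, hfc⟩ := hf.exists_le_val hMadd
      obtain ⟨c', hgc⟩ := hg.exists_le_val hMadd
      exact ⟨_, hf.mul hMadd hMmul hfc hg hgc⟩
    · exact ⟨0, IsSH.const h0 1⟩
    · rintro f g ⟨mu, hf⟩ ⟨nu, hg⟩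
      exact ⟨min mu nu, (hf.mono (min_le_left _ _)).add hMadd (hg.mono (min_le_right _ _))⟩
    · exact ⟨0, IsSH.const h0 0⟩
    · rintro f ⟨mu, hf⟩
      exact ⟨mu, hf.neg hneg⟩
end

section
/- Suppose M is a ring with val_M(mm') ≥ val_M(m) + val_M(m') for all m, m' ∈ M, and that G acts on M by E-linear isometric ring automorphisms (g(mm') = g(m)g(m')). If v ∈ ℝ and m, m' ∈ M^{G-e-sh,λ,μ} both satisfy val_M(m) ≥ v and val_M(m') ≥ v, then mm' ∈ M^{G-e-sh,λ,μ+v}. -/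
/-- Suppose `M` is a ring with `val_M (m m') ≥ val_M m + val_M m'`,
on which `G = ℤ_p^d` acts by `E`-linear isometric ring automorphisms.  If `v ∈ ℝ` and
`m, m' ∈ M^{G-e-sh,λ,μ}` satisfy `val_M m ≥ v` and `val_M m' ≥ v`, then
`m·m' ∈ M^{G-e-sh,λ,μ+v}`. -/
theorem sh_mul
    (p : ℕ) [Fact p.Prime] (E : Type*) [Field E] [CharP E p]
    (M : Type*) [Ring M] [Module E M]
    (valM : M → WithTop ℝ)
    (hMtop : ∀ m : M, valM m = ⊤ ↔ m = 0)
    (hMadd : ∀ m m' : M, min (valM m) (valM m') ≤ valM (m + m'))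
    (hMsmul : ∀ (x : E) (m : M), x ≠ 0 → valM (x • m) = valM m)
    (hMmul : ∀ m m' : M, valM m + valM m' ≤ valM (m * m'))
    (d : ℕ) (hd : 1 ≤ d)
    (σ : (Fin d → ℤ_[p]) → M →ₗ[E] M)
    (hσ_zero : σ 0 = LinearMap.id)
    (hσ_add : ∀ g h : Fin d → ℤ_[p], σ (g + h) = (σ g).comp (σ h))
    (hσ_isom : ∀ (g : Fin d → ℤ_[p]) (m : M), valM (σ g m) = valM m)
    (hσ_mul : ∀ (g : Fin d → ℤ_[p]) (m m' : M), σ g (m * m') = σ g m * σ g m')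
    (e : ℝ) (he : 0 < e) (lam mu v : ℝ) (m m' : M)
    (hv : (v : WithTop ℝ) ≤ valM m) (hv' : (v : WithTop ℝ) ≤ valM m')
    (hm : ∀ (i : ℕ) (g : Fin d → ℤ_[p]), (∀ j, (p : ℤ_[p]) ^ i ∣ g j) →
      (((p : ℝ) ^ lam * (p : ℝ) ^ (e * (i : ℝ)) + mu : ℝ) : WithTop ℝ) ≤ valM (σ g m - m))
    (hm' : ∀ (i : ℕ) (g : Fin d → ℤ_[p]), (∀ j, (p : ℤ_[p]) ^ i ∣ g j) →
      (((p : ℝ) ^ lam * (p : ℝ) ^ (e * (i : ℝ)) + mu : ℝ) : WithTop ℝ) ≤ valM (σ g m' - m')) :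
    ∀ (i : ℕ) (g : Fin d → ℤ_[p]), (∀ j, (p : ℤ_[p]) ^ i ∣ g j) →
      (((p : ℝ) ^ lam * (p : ℝ) ^ (e * (i : ℝ)) + (mu + v) : ℝ) : WithTop ℝ) ≤
        valM (σ g (m * m') - m * m') := by
  intro i g hg
  have hsplit : σ g (m * m') - m * m' = σ g m * (σ g m' - m') + (σ g m - m) * m' := by
    rw [hσ_mul]
    noncomm_ring
  rw [hsplit, ← add_assoc, WithTop.coe_add]
  refine le_trans (le_min ?_ ?_) (hMadd _ _)
  · rw [add_comm]
    exact (add_le_add (hv.trans (hσ_isom g m).ge) (hm' i g hg)).trans (hMmul _ _)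
  · exact (add_le_add (hm i g hg) hv').trans (hMmul _ _)
end

section
/- Suppose M is a ring whose valuation is multiplicative (val_M(mm') = val_M(m) + val_M(m') for all m, m' ∈ M), and that G acts on M by E-linear isometric ring automorphisms. If m ∈ M^{G-e-sh,λ,μ} is a unit of M, then its inverse satisfies 1/m ∈ M^{G-e-sh,λ,μ−2val_M(m)}. -/
/-- Suppose `M` is a ring whose valuation is multiplicative
(`val_M (m m') = val_M m + val_M m'`), on which `G = ℤ_p^d` acts by `E`-linear
isometric ring automorphisms.  If `m ∈ M^{G-e-sh,λ,μ}` is a unit of `M`, then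
`1/m ∈ M^{G-e-sh,λ,μ − 2 val_M m}`. -/
theorem sh_inv
    (p : ℕ) [Fact p.Prime] (E : Type*) [Field E] [CharP E p]
    (M : Type*) [Ring M] [Module E M] [Nontrivial M]
    (valM : M → WithTop ℝ)
    (hMtop : ∀ m : M, valM m = ⊤ ↔ m = 0)
    (hMadd : ∀ m m' : M, min (valM m) (valM m') ≤ valM (m + m'))
    (hMsmul : ∀ (x : E) (m : M), x ≠ 0 → valM (x • m) = valM m)
    (hMmul : ∀ m m' : M, valM (m * m') = valM m + valM m')
    (d : ℕ) (hd : 1 ≤ d)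
    (σ : (Fin d → ℤ_[p]) → M →ₗ[E] M)
    (hσ_zero : σ 0 = LinearMap.id)
    (hσ_add : ∀ g h : Fin d → ℤ_[p], σ (g + h) = (σ g).comp (σ h))
    (hσ_isom : ∀ (g : Fin d → ℤ_[p]) (m : M), valM (σ g m) = valM m)
    (hσ_mul : ∀ (g : Fin d → ℤ_[p]) (m m' : M), σ g (m * m') = σ g m * σ g m')
    (e : ℝ) (he : 0 < e) (lam mu : ℝ) (m : Mˣ)
    (hm : ∀ (i : ℕ) (g : Fin d → ℤ_[p]), (∀ j, (p : ℤ_[p]) ^ i ∣ g j) →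
      (((p : ℝ) ^ lam * (p : ℝ) ^ (e * (i : ℝ)) + mu : ℝ) : WithTop ℝ) ≤
        valM (σ g (m : M) - (m : M))) :
    ∃ v : ℝ, valM (m : M) = (v : WithTop ℝ) ∧
      ∀ (i : ℕ) (g : Fin d → ℤ_[p]), (∀ j, (p : ℤ_[p]) ^ i ∣ g j) →
        (((p : ℝ) ^ lam * (p : ℝ) ^ (e * (i : ℝ)) + (mu - 2 * v) : ℝ) : WithTop ℝ) ≤
          valM (σ g (↑m⁻¹ : M) - (↑m⁻¹ : M)) := by
  have eq_zero_or : ∀ a b : M, a * b = 0 → a = 0 ∨ b = 0 := by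
    intro a b hab
    have h := hMmul a b
    rw [hab, (hMtop 0).2 rfl] at h
    rcases WithTop.add_eq_top.1 h.symm with h | h
    · exact Or.inl ((hMtop a).1 h)
    · exact Or.inr ((hMtop b).1 h)
  have val_neg : ∀ a : M, valM (-a) = valM a := by
    intro a
    have h := hMsmul (-1) a (neg_ne_zero.2 one_ne_zero)
    rwa [neg_smul, one_smul] at h
  have σ_one : ∀ g, σ g 1 = 1 := by
    intro g
    have h : σ g 1 * (σ g 1 - 1) = 0 := by
      rw [mul_sub, ← hσ_mul, mul_one, mul_one, sub_self]
    rcases eq_zero_or _ _ h with h | h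
    · have h1 := hσ_isom g 1
      rw [h, (hMtop 0).2 rfl] at h1
      exact absurd ((hMtop 1).1 h1.symm) one_ne_zero
    · exact sub_eq_zero.1 h
  obtain ⟨v, hv⟩ := WithTop.ne_top_iff_exists.1 (mt (hMtop (m : M)).1 m.ne_zero)
  refine ⟨v, hv.symm, fun i g hg => ?_⟩
  have key : σ g (m : M) * (σ g (↑m⁻¹ : M) - (↑m⁻¹ : M)) * (m : M)
      = -(σ g (m : M) - (m : M)) := by
    rw [mul_sub, ← hσ_mul, Units.mul_inv, σ_one, sub_mul, one_mul, mul_assoc, Units.inv_mul,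
      mul_one, neg_sub]
  have h := hm i g hg
  rw [← val_neg, ← key, hMmul, hMmul, hσ_isom, ← hv] at h
  generalize valM (σ g (↑m⁻¹ : M) - (↑m⁻¹ : M)) = w at h ⊢
  induction w with
  | top => exact le_top
  | coe w =>
    rw [← WithTop.coe_add, ← WithTop.coe_add, WithTop.coe_le_coe] at h
    rw [WithTop.coe_le_coe]
    linarith
end
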